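/- arXiv:1102.2924 — 2 statements merged into one kernel-verified Lean document; each statement's English description precedes it below -/
import Mathlib

section
/- Let A → Ā be a homomorphism of commutative rings, let B be a commutative A-algebra, let B̄ = Ā ⊗_A B, and let J be a B̄-module. Assume Tor_1^A(B, Ā) = 0. Then pullback along the canonical map B → B̄, sending a square-zero extension of Ā-algebras 0 → J → B̄' → B̄ → 0 to the fiber product extension 0 → J → B̄' ×_{B̄} B → B → 0 of A-algebras, induces a bijection between isomorphism classes of square-zero Ā-algebra extensions of B̄ by J and isomorphism classes of square-zero A-algebra extensions of B by J (where the B-module structure on J is obtained by restriction along B → B̄). -/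
/-!
STATEMENT 2: If `Tor_1^A(B, Ā) = 0`, pulling back square-zero `Ā`-algebra extensions of
`B̄ = Ā ⊗[A] B` by `J` along the canonical map `B → B̄` (i.e. forming the fiber product
`B̄' ×_{B̄} B`) induces a bijection on isomorphism classes of square-zero extensions by `J`.
-/

open scoped TensorProduct
open CategoryTheory Limits

attribute [local instance] Algebra.TensorProduct.rightAlgebra

/-- A square-zero extension of the `R`-algebra `B` by the `B`-module `J`. -/
structure SqZeroExt (R B J : Type) [CommRing R] [CommRing B] [Algebra R B]
    [AddCommGroup J] [Module B J] where
  E : Type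
  [commRing : CommRing E]
  [algebra : Algebra R E]
  proj : E →ₐ[R] B
  proj_surjective : Function.Surjective proj
  incl : J →+ E
  incl_injective : Function.Injective incl
  range_eq_ker : ∀ x : E, proj x = 0 ↔ ∃ j : J, incl j = x
  mul_incl : ∀ (e : E) (j : J), e * incl j = incl (proj e • j)

attribute [instance] SqZeroExt.commRing SqZeroExt.algebra

/-- An isomorphism of square-zero extensions of `B` by `J`: a ring isomorphism which is
compatible with the `R`-algebra structures, commutes with the projections to `B` and
restricts to the identity on `J`. -/
def SqZeroExt.Iso {R B J : Type} [CommRing R] [CommRing B] [Algebra R B]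
    [AddCommGroup J] [Module B J] (e₁ e₂ : SqZeroExt R B J) : Prop :=
  ∃ g : e₁.E ≃+* e₂.E,
    (∀ r : R, g (algebraMap R e₁.E r) = algebraMap R e₂.E r) ∧
    (∀ x : e₁.E, e₂.proj (g x) = e₁.proj x) ∧
    (∀ j : J, g (e₁.incl j) = e₂.incl j)

section Pullback

variable (A Abar B : Type) [CommRing A] [CommRing Abar] [CommRing B]
  [Algebra A Abar] [Algebra A B]
  (J : Type) [AddCommGroup J]
  [Module B J] [Module (Abar ⊗[A] B) J]
  [IsScalarTower B (Abar ⊗[A] B) J]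

/-- The fiber product `B̄' ×_{B̄} B`, as a subring of `B̄' × B`. -/
noncomputable def pullbackSubring (ebar : SqZeroExt Abar (Abar ⊗[A] B) J) :
    Subring (ebar.E × B) :=
  RingHom.eqLocus
    (ebar.proj.toRingHom.comp (RingHom.fst ebar.E B))
    ((algebraMap B (Abar ⊗[A] B)).comp (RingHom.snd ebar.E B))

/-- The `A`-algebra structure on the fiber product `B̄' ×_{B̄} B`. -/
noncomputable def pullbackAlgebra (ebar : SqZeroExt Abar (Abar ⊗[A] B) J) :
    Algebra A (pullbackSubring A Abar B J ebar) :=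
  RingHom.toAlgebra <| RingHom.codRestrict
    (RingHom.prod ((algebraMap Abar ebar.E).comp (algebraMap A Abar)) (algebraMap A B))
    (pullbackSubring A Abar B J ebar).toSubsemiring
    (by
      intro a
      show ebar.proj (algebraMap Abar ebar.E (algebraMap A Abar a)) =
        algebraMap B (Abar ⊗[A] B) (algebraMap A B a)
      rw [AlgHom.commutes, ← IsScalarTower.algebraMap_apply, ← IsScalarTower.algebraMap_apply])

attribute [local instance] pullbackAlgebra

/-- The pullback of a square-zero `Ā`-algebra extension of `B̄` by `J` along the canonical
map `B → B̄`: the fiber product `B̄' ×_{B̄} B` is a square-zero `A`-algebra extension of `B`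
by `J`. -/
noncomputable def SqZeroExt.pullback (ebar : SqZeroExt Abar (Abar ⊗[A] B) J) :
    SqZeroExt A B J where
  E := pullbackSubring A Abar B J ebar
  commRing := inferInstance
  algebra := pullbackAlgebra A Abar B J ebar
  proj :=
    { toRingHom := (RingHom.snd ebar.E B).comp (pullbackSubring A Abar B J ebar).subtype
      commutes' := fun _ => rfl }
  proj_surjective := by
    intro b
    obtain ⟨x, hx⟩ := ebar.proj_surjective (algebraMap B (Abar ⊗[A] B) b)
    exact ⟨⟨(x, b), hx⟩, rfl⟩
  incl :=
    { toFun := fun j => ⟨(ebar.incl j, 0), by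
        show ebar.proj (ebar.incl j) = algebraMap B (Abar ⊗[A] B) 0
        rw [map_zero, (ebar.range_eq_ker (ebar.incl j)).mpr ⟨j, rfl⟩]⟩
      map_zero' := by
        apply Subtype.ext
        apply Prod.ext <;> simp
      map_add' := fun j j' => by
        apply Subtype.ext
        apply Prod.ext <;> simp }
  incl_injective := fun j j' h => ebar.incl_injective (congrArg (fun x => x.1.1) h)
  range_eq_ker := by
    rintro ⟨⟨x, b⟩, hx⟩
    have hx' : ebar.proj x = algebraMap B (Abar ⊗[A] B) b := hx
    constructor
    · intro hb
      have hb' : b = 0 := hb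
      obtain ⟨j, hj⟩ := (ebar.range_eq_ker x).mp (by rw [hx', hb', map_zero])
      exact ⟨j, Subtype.ext (Prod.ext hj hb'.symm)⟩
    · rintro ⟨j, hj⟩
      have : b = 0 := congrArg (fun y => y.1.2) hj.symm
      exact this
  mul_incl := by
    rintro ⟨⟨x, b⟩, hx⟩ j
    have hx' : ebar.proj x = algebraMap B (Abar ⊗[A] B) b := hx
    apply Subtype.ext
    apply Prod.ext
    · show x * ebar.incl j = ebar.incl (b • j)
      rw [ebar.mul_incl x j, hx', algebraMap_smul]
    · show b * 0 = 0
      ring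

end Pullback

/-- If `Tor₁(B, N)` vanishes, tensoring a short exact sequence ending in `B` with `N` preserves
injectivity. -/
lemma LinearMap.lTensor_injective_of_isZero_tor_one {R M₁ M₂ B N : Type} [CommRing R]
    [AddCommGroup M₁] [Module R M₁] [AddCommGroup M₂] [Module R M₂]
    [AddCommGroup B] [Module R B] [AddCommGroup N] [Module R N]
    (htor : IsZero (((Tor (ModuleCat R) 1).obj (ModuleCat.of R B)).obj (ModuleCat.of R N)))
    {f : M₁ →ₗ[R] M₂} {g : M₂ →ₗ[R] B} (hf : Function.Injective f)
    (hfg : Function.Exact f g) (hg : Function.Surjective g) :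
    Function.Injective (f.lTensor N) := by
  obtain ⟨P⟩ := (inferInstance : HasProjectiveResolution (ModuleCat.of R N)).out
  let d₂ : P.complex.X 2 →ₗ[R] P.complex.X 1 := (P.complex.d 2 1).hom
  let d₁ : P.complex.X 1 →ₗ[R] P.complex.X 0 := (P.complex.d 1 0).hom
  let ε : P.complex.X 0 →ₗ[R] N := (P.π.f 0).hom
  have hd : d₁ ∘ₗ d₂ = 0 := by
    rw [← ModuleCat.hom_comp, P.complex.d_comp_d]; rfl
  have hε : Function.Surjective ε := (ModuleCat.epi_iff_surjective (P.π.f 0)).1 inferInstance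
  have hdε : Function.Exact d₁ ε :=
    (ShortComplex.ShortExact.moduleCat_exact_iff_function_exact _).1 P.exact₀
  have hB : Function.Exact (d₂.lTensor B) (d₁.lTensor B) := by
    have h := htor.of_iso
      (P.isoLeftDerivedObj ((MonoidalCategory.tensoringLeft _).obj (ModuleCat.of R B)) 1).symm
    have h' := ((HomologicalComplex.exactAt_iff_isZero_homology _ _).2 h)
    rw [HomologicalComplex.exactAt_iff' _ 2 1 0 (by simp) (by simp)] at h'
    exact (ShortComplex.ShortExact.moduleCat_exact_iff_function_exact _).1 h'
  have : Projective (ModuleCat.of R (P.complex.X 0)) := P.projective 0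
  have : Module.Projective R (P.complex.X 0) := inferInstance
  have hP : Function.Injective (f.rTensor (P.complex.X 0)) :=
    Module.Flat.rTensor_preserves_injective_linearMap f hf
  rw [LinearMap.lTensor_inj_iff_rTensor_inj, injective_iff_map_eq_zero]
  intro x hx
  obtain ⟨y, rfl⟩ := LinearMap.lTensor_surjective M₁ hε x
  have hy : ε.lTensor M₂ (f.rTensor _ y) = 0 := by
    rw [← hx, ← LinearMap.comp_apply, ← LinearMap.comp_apply, LinearMap.lTensor_comp_rTensor,
      LinearMap.rTensor_comp_lTensor]
  obtain ⟨n, hn⟩ := (lTensor_exact M₂ hdε hε _).1 hy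
  have hgf : g ∘ₗ f = 0 := hfg.linearMap_comp_eq_zero
  have hn' : d₁.lTensor B (g.rTensor _ n) = 0 := by
    have : d₁.lTensor B (g.rTensor _ n) = g.rTensor _ (d₁.lTensor M₂ n) := by
      rw [← LinearMap.comp_apply, ← LinearMap.comp_apply, LinearMap.lTensor_comp_rTensor,
        LinearMap.rTensor_comp_lTensor]
    rw [this, hn, ← LinearMap.rTensor_comp_apply, hgf]
    simp
  obtain ⟨m, hm⟩ := (hB _).1 hn'
  obtain ⟨m, rfl⟩ := LinearMap.rTensor_surjective _ hg m
  have hnm : g.rTensor _ (n - d₂.lTensor M₂ m) = 0 := by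
    rw [map_sub, ← hm, sub_eq_zero, ← LinearMap.comp_apply, ← LinearMap.comp_apply,
      LinearMap.lTensor_comp_rTensor, LinearMap.rTensor_comp_lTensor]
  obtain ⟨z, hz⟩ := (rTensor_exact _ hfg hg _).1 hnm
  have hyz : y = d₁.lTensor M₁ z := by
    apply hP
    have : f.rTensor _ (d₁.lTensor M₁ z) = d₁.lTensor M₂ (f.rTensor _ z) := by
      rw [← LinearMap.comp_apply, ← LinearMap.comp_apply, LinearMap.lTensor_comp_rTensor,
        LinearMap.rTensor_comp_lTensor]
    rw [this, hz, map_sub, hn, ← LinearMap.lTensor_comp_apply, hd]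
    simp
  rw [hyz]
  exact (lTensor_exact M₁ hdε hε _).2 ⟨z, rfl⟩

namespace SqZeroExt

section Iso

variable {R B J : Type} [CommRing R] [CommRing B] [Algebra R B] [AddCommGroup J] [Module B J]
  {e₁ e₂ : SqZeroExt R B J}

lemma proj_incl (e : SqZeroExt R B J) (j : J) : e.proj (e.incl j) = 0 :=
  (e.range_eq_ker _).2 ⟨j, rfl⟩

/-- A morphism of square-zero extensions is an isomorphism. -/
lemma iso_of_ringHom (f : e₁.E →+* e₂.E)
    (hR : ∀ r : R, f (algebraMap R e₁.E r) = algebraMap R e₂.E r)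
    (hproj : ∀ x, e₂.proj (f x) = e₁.proj x) (hincl : ∀ j, f (e₁.incl j) = e₂.incl j) :
    e₁.Iso e₂ := by
  refine ⟨RingEquiv.ofBijective f ⟨?_, fun y => ?_⟩, hR, hproj, hincl⟩
  · rw [injective_iff_map_eq_zero]
    intro x hx
    obtain ⟨j, rfl⟩ := (e₁.range_eq_ker x).1 (by rw [← hproj, hx, map_zero])
    rw [hincl, ← map_zero e₂.incl] at hx
    rw [e₂.incl_injective hx, map_zero]
  · obtain ⟨x, hx⟩ := e₁.proj_surjective (e₂.proj y)
    obtain ⟨j, hj⟩ := (e₂.range_eq_ker (y - f x)).1 (by rw [map_sub, hproj, hx, sub_self])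
    exact ⟨x + e₁.incl j, by rw [map_add, hincl, hj, add_sub_cancel]⟩

lemma Iso.symm (h : e₁.Iso e₂) : e₂.Iso e₁ := by
  obtain ⟨g, hR, hproj, hincl⟩ := h
  refine ⟨g.symm, fun r => ?_, fun x => ?_, fun j => ?_⟩
  · rw [← hR, g.symm_apply_apply]
  · rw [← hproj, g.apply_symm_apply]
  · rw [← hincl, g.symm_apply_apply]

end Iso

section BaseChange

variable {A Abar B : Type} [CommRing A] [CommRing Abar] [CommRing B]
  [Algebra A Abar] [Algebra A B] {J : Type} [AddCommGroup J]
  [Module B J]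

section Kernel

variable (e : SqZeroExt A B J)

/-- The kernel of the projection of a square-zero extension, as a module over the base ring. -/
abbrev kerProj : Submodule A e.E := LinearMap.ker e.proj.toLinearMap

/-- The element of the kernel of the projection corresponding to an element of `J`. -/
def inclKer (j : J) : e.kerProj := ⟨e.incl j, e.proj_incl j⟩

/-- The identification of the kernel of the projection with `J`. -/
noncomputable def kerEquiv : J ≃+ e.kerProj :=
  AddEquiv.ofBijective (AddMonoidHom.mk' e.inclKer fun i j => Subtype.ext (e.incl.map_add i j))
    ⟨fun _ _ h => e.incl_injective (congrArg Subtype.val h), fun x => by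
      obtain ⟨j, hj⟩ := (e.range_eq_ker x.1).1 x.2
      exact ⟨j, Subtype.ext hj⟩⟩

lemma coe_kerEquiv (j : J) : (e.kerEquiv j : e.E) = e.incl j := rfl

lemma kerEquiv_symm_eq {x : e.kerProj} {j : J} (h : (x : e.E) = e.incl j) :
    e.kerEquiv.symm x = j := by
  rw [AddEquiv.symm_apply_eq]
  exact Subtype.ext h

lemma incl_kerEquiv_symm (x : e.kerProj) : e.incl (e.kerEquiv.symm x) = x := by
  rw [← coe_kerEquiv, AddEquiv.apply_symm_apply]

lemma kerEquiv_symm_of_mul {c : e.E} {x y : e.kerProj} (h : (y : e.E) = c * x) :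
    e.kerEquiv.symm y = e.proj c • e.kerEquiv.symm x := by
  apply e.kerEquiv_symm_eq
  rw [h, ← e.mul_incl, incl_kerEquiv_symm]

variable (Abar) in
/-- The base change of the projection. -/
noncomputable def projBar : Abar ⊗[A] e.E →ₐ[Abar] Abar ⊗[A] B :=
  Algebra.TensorProduct.map (AlgHom.id Abar Abar) e.proj

lemma projBar_tmul (a : Abar) (x : e.E) : e.projBar Abar (a ⊗ₜ x) = a ⊗ₜ e.proj x := rfl

lemma projBar_surjective : Function.Surjective (e.projBar Abar) :=
  LinearMap.lTensor_surjective Abar (g := e.proj.toLinearMap) e.proj_surjective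

variable (Abar) in
/-- The base change of the inclusion of the kernel of the projection. -/
noncomputable def kerBar : Abar ⊗[A] e.kerProj →ₗ[A] Abar ⊗[A] e.E :=
  e.kerProj.subtype.lTensor Abar

lemma kerBar_tmul (a : Abar) (x : e.kerProj) : e.kerBar Abar (a ⊗ₜ x) = a ⊗ₜ (x : e.E) := rfl

lemma exact_kerBar_projBar : Function.Exact (e.kerBar Abar) (e.projBar Abar) :=
  lTensor_exact Abar (LinearMap.exact_subtype_ker_map e.proj.toLinearMap) e.proj_surjective

end Kernel

variable [Module (Abar ⊗[A] B) J]

/-- A morphism from an extension of `B` by `J` to an extension of `Ā ⊗[A] B` by `J`, over the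
canonical map `B → Ā ⊗[A] B` and under `J`. -/
structure IsHomOver (e : SqZeroExt A B J) (ebar : SqZeroExt Abar (Abar ⊗[A] B) J)
    (f : e.E →+* ebar.E) : Prop where
  map_algebraMap : ∀ a : A, f (algebraMap A e.E a) = algebraMap Abar ebar.E (algebraMap A Abar a)
  proj_map : ∀ x, ebar.proj (f x) = 1 ⊗ₜ[A] e.proj x
  map_incl : ∀ j, f (e.incl j) = ebar.incl j

lemma IsHomOver.comp_iso {e₁ e₂ : SqZeroExt A B J} {ebar : SqZeroExt Abar (Abar ⊗[A] B) J}
    {f : e₂.E →+* ebar.E} (hf : IsHomOver e₂ ebar f) (h : e₁.Iso e₂) :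
    ∃ f', IsHomOver e₁ ebar f' := by
  obtain ⟨g, hR, hproj, hincl⟩ := h
  refine ⟨f.comp g.toRingHom, fun a => ?_, fun x => ?_, fun j => ?_⟩
  · exact (congrArg f (hR a)).trans (hf.map_algebraMap a)
  · exact (hf.proj_map _).trans (congrArg _ (hproj x))
  · exact (congrArg f (hincl j)).trans (hf.map_incl j)

lemma IsHomOver.iso_comp {e : SqZeroExt A B J} {ebar₁ ebar₂ : SqZeroExt Abar (Abar ⊗[A] B) J}
    {f : e.E →+* ebar₁.E} (hf : IsHomOver e ebar₁ f) (h : ebar₁.Iso ebar₂) :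
    ∃ f', IsHomOver e ebar₂ f' := by
  obtain ⟨g, hR, hproj, hincl⟩ := h
  refine ⟨g.toRingHom.comp f, fun a => ?_, fun x => ?_, fun j => ?_⟩
  · exact (congrArg g (hf.map_algebraMap a)).trans (hR _)
  · exact (hproj _).trans (hf.proj_map x)
  · exact (congrArg g (hf.map_incl j)).trans (hincl j)

variable [IsScalarTower B (Abar ⊗[A] B) J]

lemma exists_isHomOver_pullback (ebar : SqZeroExt Abar (Abar ⊗[A] B) J) :
    ∃ f, IsHomOver (ebar.pullback A Abar B J) ebar f :=
  ⟨(RingHom.fst ebar.E B).comp (pullbackSubring A Abar B J ebar).subtype,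
    fun _ => rfl, fun x => x.2, fun _ => rfl⟩

lemma IsHomOver.iso_pullback {e : SqZeroExt A B J} {ebar : SqZeroExt Abar (Abar ⊗[A] B) J}
    {f : e.E →+* ebar.E} (hf : IsHomOver e ebar f) : e.Iso (ebar.pullback A Abar B J) := by
  refine iso_of_ringHom (e₂ := ebar.pullback A Abar B J)
    ((f.prod e.proj.toRingHom).codRestrict (pullbackSubring A Abar B J ebar) hf.proj_map)
    (fun a => ?_) (fun x => rfl) (fun j => ?_)
  · exact Subtype.ext (Prod.ext (hf.map_algebraMap a) (e.proj.commutes a))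
  · exact Subtype.ext (Prod.ext (hf.map_incl j) (e.proj_incl j))

variable (e : SqZeroExt A B J)

variable (Abar) in
/-- The action map `Ā ⊗[A] J → J`, with `J` viewed as the kernel of the projection. -/
noncomputable def action : Abar ⊗[A] e.kerProj →+ J :=
  TensorProduct.liftAddHom
    (AddMonoidHom.mk' (fun a : Abar =>
        (DistribSMul.toAddMonoidHom J (a ⊗ₜ[A] (1 : B))).comp e.kerEquiv.symm.toAddMonoidHom)
      fun a b => by
        ext x
        simp [TensorProduct.add_tmul, add_smul])
    fun r a x => by
      have h : e.kerEquiv.symm (r • x) = algebraMap A B r • e.kerEquiv.symm x := by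
        rw [← e.proj.commutes]
        exact e.kerEquiv_symm_of_mul (Algebra.smul_def r (x : e.E))
      have h' : ((r • a) ⊗ₜ[A] (1 : B)) = (a ⊗ₜ[A] (1 : B)) * algebraMap B (Abar ⊗[A] B)
          (algebraMap A B r) := by
        rw [TensorProduct.smul_tmul, Algebra.smul_def, mul_one,
          Algebra.TensorProduct.right_algebraMap_apply, Algebra.TensorProduct.tmul_mul_tmul,
          mul_one, one_mul]
      simp only [AddMonoidHom.mk'_apply, AddMonoidHom.comp_apply,
        DistribSMul.toAddMonoidHom_apply, AddEquiv.toAddMonoidHom_eq_coe,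
        AddMonoidHom.coe_coe, h, h', mul_smul, algebraMap_smul]

lemma action_tmul (a : Abar) (x : e.kerProj) :
    e.action Abar (a ⊗ₜ x) = (a ⊗ₜ[A] (1 : B)) • e.kerEquiv.symm x := rfl

lemma action_one_tmul (j : J) : e.action Abar (1 ⊗ₜ e.kerEquiv j) = j := by
  rw [action_tmul, AddEquiv.symm_apply_apply, ← Algebra.TensorProduct.one_def, one_smul]

lemma exists_kerBar_eq_mul (c : Abar ⊗[A] e.E) (x : Abar ⊗[A] e.kerProj) :
    ∃ y, e.kerBar Abar y = c * e.kerBar Abar x ∧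
      e.action Abar y = e.projBar Abar c • e.action Abar x := by
  induction c with
  | zero => exact ⟨0, by simp⟩
  | add c d hc hd =>
    obtain ⟨y, hy, hy'⟩ := hc
    obtain ⟨z, hz, hz'⟩ := hd
    exact ⟨y + z, by rw [map_add, hy, hz, add_mul], by rw [map_add, hy', hz', map_add, add_smul]⟩
  | tmul a t =>
    induction x with
    | zero => exact ⟨0, by simp⟩
    | add c d hc hd =>
      obtain ⟨y, hy, hy'⟩ := hc
      obtain ⟨z, hz, hz'⟩ := hd
      exact ⟨y + z, by rw [map_add, hy, hz, map_add, mul_add],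
        by rw [map_add, hy', hz', map_add, smul_add]⟩
    | tmul b x =>
      have hx : t * (x : e.E) ∈ e.kerProj := by
        have : e.proj (x : e.E) = 0 := x.2
        simp [this]
      refine ⟨(a * b) ⊗ₜ ⟨t * x, hx⟩, ?_, ?_⟩
      · rw [kerBar_tmul, kerBar_tmul, Algebra.TensorProduct.tmul_mul_tmul]
      · rw [action_tmul, action_tmul, projBar_tmul,
          e.kerEquiv_symm_of_mul (c := t) (x := x) rfl,
          ← algebraMap_smul (Abar ⊗[A] B) (e.proj t), smul_smul, smul_smul,
          Algebra.TensorProduct.right_algebraMap_apply, Algebra.TensorProduct.tmul_mul_tmul,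
          Algebra.TensorProduct.tmul_mul_tmul]
        simp

variable (Abar) in
/-- The image in `Ā ⊗[A] E` of the kernel of the action map `Ā ⊗[A] J → J`. -/
noncomputable def kerAction : Ideal (Abar ⊗[A] e.E) where
  carrier := {t | ∃ x, e.kerBar Abar x = t ∧ e.action Abar x = 0}
  zero_mem' := ⟨0, map_zero _, map_zero _⟩
  add_mem' := by
    rintro _ _ ⟨x, rfl, hx⟩ ⟨y, rfl, hy⟩
    exact ⟨x + y, map_add _ _ _, by rw [map_add, hx, hy, add_zero]⟩
  smul_mem' := by
    rintro c _ ⟨x, rfl, hx⟩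
    obtain ⟨y, hy, hy'⟩ := e.exists_kerBar_eq_mul c x
    exact ⟨y, hy, by rw [hy', hx, smul_zero]⟩

lemma mem_kerAction {t : Abar ⊗[A] e.E} :
    t ∈ e.kerAction Abar ↔ ∃ x, e.kerBar Abar x = t ∧ e.action Abar x = 0 := Iff.rfl

lemma kerBar_sub_one_tmul_mem (x : Abar ⊗[A] e.kerProj) :
    e.kerBar Abar x - 1 ⊗ₜ e.incl (e.action Abar x) ∈ e.kerAction Abar :=
  ⟨x - 1 ⊗ₜ e.kerEquiv (e.action Abar x), by rw [map_sub, kerBar_tmul, coe_kerEquiv],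
    by rw [map_sub, action_one_tmul, sub_self]⟩

/-- A morphism over the base change extends to `Ā ⊗[A] E`, and the kernel of the extension
does not depend on the target. -/
lemma IsHomOver.exists_algHom {e : SqZeroExt A B J} {ebar : SqZeroExt Abar (Abar ⊗[A] B) J}
    {f : e.E →+* ebar.E} (hf : IsHomOver e ebar f) :
    ∃ φ : Abar ⊗[A] e.E →ₐ[Abar] ebar.E, Function.Surjective φ ∧
      RingHom.ker φ.toRingHom = e.kerAction Abar ∧
      (∀ t, ebar.proj (φ t) = e.projBar Abar t) ∧ ∀ j, φ (1 ⊗ₜ e.incl j) = ebar.incl j := by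
  let : Algebra A ebar.E := ((algebraMap Abar ebar.E).comp (algebraMap A Abar)).toAlgebra
  have : IsScalarTower A Abar ebar.E := IsScalarTower.of_algebraMap_eq fun _ => rfl
  let f' : e.E →ₐ[A] ebar.E := { f with commutes' := hf.map_algebraMap }
  let φ : Abar ⊗[A] e.E →ₐ[Abar] ebar.E :=
    Algebra.TensorProduct.lift (Algebra.ofId Abar ebar.E) f' fun _ _ => Commute.all _ _
  have hφ (a : Abar) (x : e.E) : φ (a ⊗ₜ x) = algebraMap Abar ebar.E a * f x :=
    Algebra.TensorProduct.lift_tmul ..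
  have hproj (t) : ebar.proj (φ t) = e.projBar Abar t := by
    induction t with
    | zero => simp
    | add s t hs ht => simp only [map_add, hs, ht]
    | tmul a x =>
      rw [hφ, map_mul, hf.proj_map, projBar_tmul, AlgHom.commutes,
        Algebra.TensorProduct.algebraMap_apply, Algebra.TensorProduct.tmul_mul_tmul]
      simp
  have hincl (j) : φ (1 ⊗ₜ e.incl j) = ebar.incl j := by
    rw [hφ, map_one, one_mul, hf.map_incl]
  have hker (x) : φ (e.kerBar Abar x) = ebar.incl (e.action Abar x) := by
    induction x with
    | zero => simp
    | add s t hs ht => simp only [map_add, hs, ht]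
    | tmul a x =>
      rw [kerBar_tmul, hφ, action_tmul, ← e.incl_kerEquiv_symm, hf.map_incl, ebar.mul_incl,
        AlgHom.commutes, Algebra.TensorProduct.algebraMap_apply]
      rfl
  refine ⟨φ, fun y => ?_, ?_, hproj, hincl⟩
  · obtain ⟨t, ht⟩ := e.projBar_surjective (ebar.proj y)
    obtain ⟨j, hj⟩ := (ebar.range_eq_ker (y - φ t)).1 (by rw [map_sub, hproj, ht, sub_self])
    exact ⟨t + 1 ⊗ₜ e.incl j, by rw [map_add, hincl, hj, add_sub_cancel]⟩
  · ext t
    rw [mem_kerAction]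
    constructor
    · intro ht
      have ht : φ t = 0 := ht
      obtain ⟨x, rfl⟩ := (e.exact_kerBar_projBar t).1 (by rw [← hproj, ht, map_zero])
      exact ⟨x, rfl, ebar.incl_injective (by rw [← hker, ht, map_zero])⟩
    · rintro ⟨x, rfl, hx⟩
      exact (hker x).trans (by rw [hx, map_zero])

lemma IsHomOver.iso {e : SqZeroExt A B J} {ebar₁ ebar₂ : SqZeroExt Abar (Abar ⊗[A] B) J}
    {f₁ : e.E →+* ebar₁.E} {f₂ : e.E →+* ebar₂.E} (h₁ : IsHomOver e ebar₁ f₁)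
    (h₂ : IsHomOver e ebar₂ f₂) : ebar₁.Iso ebar₂ := by
  obtain ⟨φ₁, hs₁, hk₁, hp₁, hi₁⟩ := h₁.exists_algHom
  obtain ⟨φ₂, -, hk₂, hp₂, hi₂⟩ := h₂.exists_algHom
  let ψ : ebar₁.E →+* ebar₂.E :=
    φ₁.toRingHom.liftOfSurjective hs₁ ⟨φ₂.toRingHom, (hk₁.trans hk₂.symm).le⟩
  have hψ (t) : ψ (φ₁ t) = φ₂ t := φ₁.toRingHom.liftOfRightInverse_comp_apply _ _ _ t
  refine iso_of_ringHom ψ (fun a => ?_) (fun x => ?_) (fun j => ?_)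
  · rw [← φ₁.commutes, hψ, φ₂.commutes]
  · obtain ⟨t, rfl⟩ := hs₁ x
    rw [hψ, hp₁, hp₂]
  · rw [← hi₁, hψ, hi₂]

/-- The pushout of `Ā ⊗[A] E` along the action map `Ā ⊗[A] J → J`, as a square-zero extension of
`Ā ⊗[A] B` by `J`. -/
noncomputable def pushout (hinj : Function.Injective (e.kerBar Abar)) :
    SqZeroExt Abar (Abar ⊗[A] B) J where
  E := (Abar ⊗[A] e.E) ⧸ e.kerAction Abar
  proj := Ideal.Quotient.liftₐ (e.kerAction Abar) (e.projBar Abar) <| by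
    rintro _ ⟨x, rfl, -⟩
    exact (e.exact_kerBar_projBar _).2 ⟨x, rfl⟩
  proj_surjective := fun b => by
    obtain ⟨t, ht⟩ := e.projBar_surjective b
    exact ⟨Ideal.Quotient.mk _ t, ht⟩
  incl := AddMonoidHom.mk' (fun j => Ideal.Quotient.mk _ (1 ⊗ₜ e.incl j)) fun i j => by
    rw [map_add, TensorProduct.tmul_add, map_add]
  incl_injective := by
    rw [injective_iff_map_eq_zero]
    intro j hj
    obtain ⟨x, hx, hx'⟩ := Ideal.Quotient.eq_zero_iff_mem.1 hj
    rw [← e.coe_kerEquiv, ← kerBar_tmul] at hx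
    rw [← e.action_one_tmul (Abar := Abar) j, ← hinj hx, hx']
  range_eq_ker := fun x => by
    obtain ⟨t, rfl⟩ := Ideal.Quotient.mk_surjective x
    constructor
    · intro ht
      obtain ⟨x, rfl⟩ := (e.exact_kerBar_projBar t).1 ht
      exact ⟨e.action Abar x, (Ideal.Quotient.eq.2 (e.kerBar_sub_one_tmul_mem x)).symm⟩
    · rintro ⟨j, hj⟩
      rw [← hj]
      show e.projBar Abar (1 ⊗ₜ e.incl j) = 0
      rw [projBar_tmul, proj_incl, TensorProduct.tmul_zero]
  mul_incl := fun x j => by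
    obtain ⟨t, rfl⟩ := Ideal.Quotient.mk_surjective x
    obtain ⟨y, hy, hy'⟩ := e.exists_kerBar_eq_mul t (1 ⊗ₜ e.kerEquiv j)
    rw [action_one_tmul] at hy'
    have h := Ideal.Quotient.eq.2 (e.kerBar_sub_one_tmul_mem y)
    rw [hy, hy', map_mul] at h
    exact h

lemma isHomOver_pushout (hinj : Function.Injective (e.kerBar Abar)) :
    IsHomOver e (e.pushout hinj) ((Ideal.Quotient.mk (e.kerAction Abar)).comp
      (Algebra.TensorProduct.includeRight : e.E →ₐ[A] Abar ⊗[A] e.E).toRingHom) where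
  map_algebraMap a := by
    show Ideal.Quotient.mk (e.kerAction Abar) (1 ⊗ₜ algebraMap A e.E a) =
      Ideal.Quotient.mk (e.kerAction Abar) (algebraMap Abar _ (algebraMap A Abar a))
    rw [Algebra.TensorProduct.algebraMap_apply, Algebra.algebraMap_eq_smul_one,
      ← TensorProduct.smul_tmul, ← Algebra.algebraMap_eq_smul_one]
    rfl
  proj_map _ := rfl
  map_incl _ := rfl

end BaseChange

end SqZeroExt

theorem sqZeroExt_pullback_bijective_on_isoClasses
    (A Abar B : Type) [CommRing A] [CommRing Abar] [CommRing B]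
    [Algebra A Abar] [Algebra A B]
    (J : Type) [AddCommGroup J]
    [Module B J] [Module (Abar ⊗[A] B) J]
    [IsScalarTower B (Abar ⊗[A] B) J]
    (htor : IsZero (((Tor (ModuleCat A) 1).obj (ModuleCat.of A B)).obj (ModuleCat.of A Abar))) :
    (∀ e : SqZeroExt A B J, ∃ ebar : SqZeroExt Abar (Abar ⊗[A] B) J,
      (ebar.pullback A Abar B J).Iso e) ∧
    (∀ ebar₁ ebar₂ : SqZeroExt Abar (Abar ⊗[A] B) J,
      (ebar₁.pullback A Abar B J).Iso (ebar₂.pullback A Abar B J) ↔ ebar₁.Iso ebar₂) := by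
  refine ⟨fun e => ?_, fun ebar₁ ebar₂ => ⟨fun h => ?_, fun h => ?_⟩⟩
  · have hinj : Function.Injective (e.kerBar Abar) :=
      LinearMap.lTensor_injective_of_isZero_tor_one htor e.kerProj.subtype_injective
        (LinearMap.exact_subtype_ker_map e.proj.toLinearMap) e.proj_surjective
    exact ⟨e.pushout hinj, (e.isHomOver_pushout hinj).iso_pullback.symm⟩
  · obtain ⟨f₁, h₁⟩ := ebar₁.exists_isHomOver_pullback
    obtain ⟨f₂, h₂⟩ := ebar₂.exists_isHomOver_pullback
    obtain ⟨f, hf⟩ := h₂.comp_iso h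
    exact h₁.iso hf
  · obtain ⟨f₁, h₁⟩ := ebar₁.exists_isHomOver_pullback
    obtain ⟨f, hf⟩ := h₁.iso_comp h
    exact hf.iso_pullback
end

section
/- Let A be a commutative ring, Ā a commutative A-algebra, n ≥ 0 an integer, and f : C → B a surjective A-algebra homomorphism. Assume Tor_q^A(C, Ā) = 0 and Tor_q^A(B, Ā) = 0 for all q with 0 < q ≤ n. For p ≥ 0, let C_p denote the (p+1)-fold fiber product of C over B, i.e., the A-subalgebra of the product ring C^{p+1} consisting of tuples (c_0, …, c_p) with f(c_0) = f(c_1) = ⋯ = f(c_p). Then Tor_q^A(C_p, Ā) = 0 for all q with 0 < q ≤ n − p. -/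
/-!
STATEMENT 6: If `f : C → B` is a surjective `A`-algebra map with `Tor_q^A(C, Ā) = 0` and
`Tor_q^A(B, Ā) = 0` for `0 < q ≤ n`, then the `(p+1)`-fold fiber product `C_p` of `C` over
`B` satisfies `Tor_q^A(C_p, Ā) = 0` for `0 < q ≤ n - p`.
-/

open CategoryTheory Limits

/-- The `(p+1)`-fold fiber product of `C` over `B` along `f`: the `A`-subalgebra of
`C^{p+1}` of tuples all of whose components have the same image in `B`. -/
def iteratedFiberProduct (A B C : Type) [CommRing A] [CommRing B] [CommRing C]
    [Algebra A B] [Algebra A C] (f : C →ₐ[A] B) (p : ℕ) :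
    Subalgebra A (Fin (p + 1) → C) :=
  ⨅ i : Fin (p + 1),
    AlgHom.equalizer
      (f.comp (Pi.evalAlgHom A (fun _ : Fin (p + 1) => C) i))
      (f.comp (Pi.evalAlgHom A (fun _ : Fin (p + 1) => C) 0))

open MonoidalCategory

universe u

/-- A short complex `S` of `A`-modules tensored with a chain complex `P` of `A`-modules. -/
noncomputable def tensorShortComplex {A : Type u} [CommRing A]
    (S : ShortComplex (ModuleCat.{u} A)) (P : ChainComplex (ModuleCat.{u} A) ℕ) :
    ShortComplex (ChainComplex (ModuleCat.{u} A) ℕ) where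
  X₁ := (((tensoringLeft (ModuleCat.{u} A)).obj S.X₁).mapHomologicalComplex _).obj P
  X₂ := (((tensoringLeft (ModuleCat.{u} A)).obj S.X₂).mapHomologicalComplex _).obj P
  X₃ := (((tensoringLeft (ModuleCat.{u} A)).obj S.X₃).mapHomologicalComplex _).obj P
  f := (NatTrans.mapHomologicalComplex ((tensoringLeft (ModuleCat.{u} A)).map S.f) _).app P
  g := (NatTrans.mapHomologicalComplex ((tensoringLeft (ModuleCat.{u} A)).map S.g) _).app P
  zero := by
    rw [← NatTrans.comp_app, ← NatTrans.mapHomologicalComplex_comp, ← Functor.map_comp, S.zero]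
    ext : 1
    simp
    rfl

lemma tensorShortComplex_shortExact {A : Type u} [CommRing A]
    {S : ShortComplex (ModuleCat.{u} A)} (hS : S.ShortExact)
    (P : ChainComplex (ModuleCat.{u} A) ℕ) (hP : ∀ i, Projective (P.X i)) :
    (tensorShortComplex S P).ShortExact := by
  refine HomologicalComplex.shortExact_of_degreewise_shortExact _ fun i => ?_
  have : Module.Projective A (P.X i) := (IsProjective.iff_projective _).2 (hP i)
  have hex := (ShortComplex.ShortExact.moduleCat_exact_iff_function_exact S).1 hS.exact
  have hinj := (ModuleCat.mono_iff_injective _).1 hS.mono_f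
  have hsurj := (ModuleCat.epi_iff_surjective _).1 hS.epi_g
  exact
    { exact := (ShortComplex.ShortExact.moduleCat_exact_iff_function_exact _).2
        (Module.Flat.rTensor_exact (P.X i) hex)
      mono_f := (ModuleCat.mono_iff_injective _).2
        (Module.Flat.rTensor_preserves_injective_linearMap S.f.hom hinj)
      epi_g := (ModuleCat.epi_iff_surjective _).2 (LinearMap.rTensor_surjective _ hsurj) }

lemma isZero_tor_iff {A : Type u} [CommRing A] (X : ModuleCat.{u} A) {Y : ModuleCat.{u} A}
    (P : ProjectiveResolution Y) (q : ℕ) :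
    IsZero (((Tor (ModuleCat.{u} A) q).obj X).obj Y) ↔
      IsZero (HomologicalComplex.homology
        ((((tensoringLeft (ModuleCat.{u} A)).obj X).mapHomologicalComplex _).obj P.complex) q) :=
  (P.isoLeftDerivedObj ((tensoringLeft (ModuleCat.{u} A)).obj X) q).isZero_iff

lemma isZero_tor_X₂ {A : Type u} [CommRing A] {S : ShortComplex (ModuleCat.{u} A)}
    (hS : S.ShortExact) (Y : ModuleCat.{u} A) (q : ℕ)
    (h₁ : IsZero (((Tor (ModuleCat.{u} A) q).obj S.X₁).obj Y))
    (h₃ : IsZero (((Tor (ModuleCat.{u} A) q).obj S.X₃).obj Y)) :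
    IsZero (((Tor (ModuleCat.{u} A) q).obj S.X₂).obj Y) := by
  let P := projectiveResolution Y
  rw [isZero_tor_iff _ P] at *
  exact ((tensorShortComplex_shortExact hS P.complex P.projective).homology_exact₂
    q).isZero_of_both_isZero h₁ h₃

lemma isZero_tor_X₁ {A : Type u} [CommRing A] {S : ShortComplex (ModuleCat.{u} A)}
    (hS : S.ShortExact) (Y : ModuleCat.{u} A) (q : ℕ)
    (h₂ : IsZero (((Tor (ModuleCat.{u} A) q).obj S.X₂).obj Y))
    (h₃ : IsZero (((Tor (ModuleCat.{u} A) (q + 1)).obj S.X₃).obj Y)) :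
    IsZero (((Tor (ModuleCat.{u} A) q).obj S.X₁).obj Y) := by
  let P := projectiveResolution Y
  rw [isZero_tor_iff _ P] at *
  exact ((tensorShortComplex_shortExact hS P.complex P.projective).homology_exact₁
    (q + 1) q (by simp)).isZero_of_both_isZero h₃ h₂

lemma ModuleCat.shortExact_of_exact {A M₁ M₂ M₃ : Type u} [CommRing A] [AddCommGroup M₁]
    [AddCommGroup M₂] [AddCommGroup M₃] [Module A M₁] [Module A M₂] [Module A M₃]
    (i : M₁ →ₗ[A] M₂) (g : M₂ →ₗ[A] M₃) (hi : Function.Injective i) (hig : Function.Exact i g)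
    (hg : Function.Surjective g) :
    (ShortComplex.mk (ModuleCat.ofHom i) (ModuleCat.ofHom g)
      (by ext x; exact hig.apply_apply_eq_zero x)).ShortExact where
  exact := (ShortComplex.ShortExact.moduleCat_exact_iff_function_exact _).2 hig
  mono_f := (ModuleCat.mono_iff_injective _).2 hi
  epi_g := (ModuleCat.epi_iff_surjective _).2 hg

section IteratedFiberProduct

variable {A B C : Type} [CommRing A] [CommRing B] [CommRing C] [Algebra A B] [Algebra A C]
  (f : C →ₐ[A] B)

lemma mem_iteratedFiberProduct {p : ℕ} {c : Fin (p + 1) → C} :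
    c ∈ iteratedFiberProduct A B C f p ↔ ∀ i, f (c i) = f (c 0) := by
  simp [iteratedFiberProduct, Algebra.mem_iInf, AlgHom.mem_equalizer]

/-- Forgetting all components but the first identifies `C_0` with `C`. -/
noncomputable def iteratedFiberProductZeroEquiv :
    iteratedFiberProduct A B C f 0 ≃ₗ[A] C :=
  LinearEquiv.ofBijective
    ((LinearMap.proj 0).comp (iteratedFiberProduct A B C f 0).val.toLinearMap)
    ⟨fun x y h => Subtype.ext <| funext fun i => by
      rw [Fin.fin_one_eq_zero i]
      exact h,
    fun c => ⟨⟨fun _ => c, (mem_iteratedFiberProduct f).2 fun _ => rfl⟩, rfl⟩⟩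

/-- The projection `C_{p+1} → C_p` forgetting the last component. -/
def iteratedFiberProductInit (p : ℕ) :
    iteratedFiberProduct A B C f (p + 1) →ₗ[A] iteratedFiberProduct A B C f p where
  toFun c := ⟨Fin.init c.1, (mem_iteratedFiberProduct f).2 fun i =>
    (mem_iteratedFiberProduct f).1 c.2 i.castSucc⟩
  map_add' _ _ := rfl
  map_smul' _ _ := rfl

/-- The inclusion `ker f → C_{p+1}` into the last component. -/
def kerToIteratedFiberProduct (p : ℕ) :
    LinearMap.ker f.toLinearMap →ₗ[A] iteratedFiberProduct A B C f (p + 1) :=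
  ((LinearMap.single A (fun _ : Fin (p + 1 + 1) => C) (Fin.last (p + 1))).comp
    (Submodule.subtype _)).codRestrict (iteratedFiberProduct A B C f (p + 1)).toSubmodule
    fun x => (mem_iteratedFiberProduct f).2 fun i => by
      have hx : f x = 0 := x.2
      have h (j : Fin (p + 1 + 1)) :
          f ((Pi.single (Fin.last (p + 1)) (x : C) : Fin (p + 1 + 1) → C) j) = 0 := by
        by_cases hj : j = Fin.last (p + 1)
        · subst hj
          simpa using hx
        · simp [Pi.single_eq_of_ne hj]
      exact (h i).trans (h 0).symm

lemma coe_kerToIteratedFiberProduct (p : ℕ) (x : LinearMap.ker f.toLinearMap) :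
    (kerToIteratedFiberProduct f p x : Fin (p + 1 + 1) → C) =
      Pi.single (Fin.last (p + 1)) (x : C) :=
  rfl

lemma kerToIteratedFiberProduct_injective (p : ℕ) :
    Function.Injective (kerToIteratedFiberProduct f p) := fun _ _ h =>
  Subtype.ext <| Pi.single_injective (M := fun _ : Fin (p + 1 + 1) => C) _ <|
    congrArg Subtype.val h

lemma iteratedFiberProductInit_surjective (p : ℕ) :
    Function.Surjective (iteratedFiberProductInit f p) := fun c =>
  ⟨⟨Fin.snoc (α := fun _ => C) c.1 (c.1 0), (mem_iteratedFiberProduct f).2 fun i => by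
    have h0 : (Fin.snoc (α := fun _ => C) c.1 (c.1 0) : Fin (p + 1 + 1) → C) 0 = c.1 0 :=
      Fin.snoc_castSucc (α := fun _ => C) _ _ 0
    rw [h0]
    refine Fin.lastCases ?_ (fun j => ?_) i
    · rw [Fin.snoc_last]
    · rw [Fin.snoc_castSucc]
      exact (mem_iteratedFiberProduct f).1 c.2 j⟩,
  Subtype.ext (Fin.init_snoc (α := fun _ => C) _ _)⟩

lemma exact_kerToIteratedFiberProduct_init (p : ℕ) :
    Function.Exact (kerToIteratedFiberProduct f p) (iteratedFiberProductInit f p) := by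
  intro c
  constructor
  · intro hc
    have hc' (j : Fin (p + 1)) : c.1 j.castSucc = 0 := congrFun (congrArg Subtype.val hc) j
    have hlast : f (c.1 (Fin.last (p + 1))) = 0 := by
      rw [(mem_iteratedFiberProduct f).1 c.2, ← Fin.castSucc_zero, hc', map_zero]
    refine ⟨⟨c.1 (Fin.last (p + 1)), hlast⟩, Subtype.ext <| funext fun i => ?_⟩
    rw [coe_kerToIteratedFiberProduct]
    refine Fin.lastCases ?_ (fun j => ?_) i
    · simp
    · rw [hc', Pi.single_eq_of_ne (Fin.castSucc_ne_last j)]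
  · rintro ⟨x, rfl⟩
    refine Subtype.ext <| funext fun j => ?_
    exact Pi.single_eq_of_ne (Fin.castSucc_ne_last j) _

end IteratedFiberProduct

theorem tor_iteratedFiberProduct_vanishing
    (A Abar B C : Type) [CommRing A] [CommRing Abar] [CommRing B] [CommRing C]
    [Algebra A Abar] [Algebra A B] [Algebra A C]
    (n : ℕ) (f : C →ₐ[A] B) (hf : Function.Surjective f)
    (hC : ∀ q : ℕ, 0 < q → q ≤ n →
      IsZero (((Tor (ModuleCat A) q).obj (ModuleCat.of A C)).obj (ModuleCat.of A Abar)))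
    (hB : ∀ q : ℕ, 0 < q → q ≤ n →
      IsZero (((Tor (ModuleCat A) q).obj (ModuleCat.of A B)).obj (ModuleCat.of A Abar))) :
    ∀ (p q : ℕ), 0 < q → q ≤ n - p →
      IsZero (((Tor (ModuleCat A) q).obj
        (ModuleCat.of A (iteratedFiberProduct A B C f p))).obj (ModuleCat.of A Abar)) := by
  have hker (q : ℕ) (h0 : 0 < q) (hq : q + 1 ≤ n) :
      IsZero (((Tor (ModuleCat A) q).obj
        (ModuleCat.of A (LinearMap.ker f.toLinearMap))).obj (ModuleCat.of A Abar)) :=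
    isZero_tor_X₁ (ModuleCat.shortExact_of_exact _ f.toLinearMap (Submodule.subtype_injective _)
      f.toLinearMap.exact_subtype_ker_map hf) _ q (hC q h0 (by lia)) (hB (q + 1) (by lia) hq)
  intro p
  induction p with
  | zero =>
    intro q h0 hq
    exact (hC q h0 hq).of_iso <| ((Tor (ModuleCat A) q).mapIso
      (iteratedFiberProductZeroEquiv f).toModuleIso).app (ModuleCat.of A Abar)
  | succ p ih =>
    intro q h0 hq
    exact isZero_tor_X₂ (ModuleCat.shortExact_of_exact _ _
      (kerToIteratedFiberProduct_injective f p) (exact_kerToIteratedFiberProduct_init f p)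
      (iteratedFiberProductInit_surjective f p)) _ q (hker q h0 (by lia)) (ih q h0 (by lia))
end
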